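/- Let k be a field, d ≥ 5 an integer, S = k[x_1,…,x_d,y_1,…,y_d], and fix an integer a with 2 ≤ a ≤ d − 1. Let I(G_{d,a}) = x_1(y_1,…,y_d) + (x_i y_j : 2 ≤ i ≤ j ≤ a) + (x_i y_j : a+1 ≤ i ≤ j ≤ d). Then depth(S/(I(G_{d,a})^2 : (x_1 y_d))) ≥ min(a, d − a + 1). -/

import Mathlib

open MvPolynomial

/-- The maximal homogeneous ideal of the polynomial ring, generated by all variables. -/
noncomputable def maxHomIdeal (k : Type) [Field k] (V : Type) : Ideal (MvPolynomial V k) :=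
  Ideal.span (Set.range (X : V → MvPolynomial V k))

/-- `depthQuot k I` is the depth of `S/I` where `S = k[x_v : v ∈ V]`, defined as
`min {i : H^i_m(S/I) ≠ 0}` where `m` is the maximal homogeneous ideal and `H^i_m` is
local cohomology. -/
noncomputable def depthQuot (k : Type) [Field k] {V : Type} (I : Ideal (MvPolynomial V k)) : ℕ :=
  sInf {i : ℕ |
    Nontrivial ((localCohomology (maxHomIdeal k V) i).obj
      (ModuleCat.of (MvPolynomial V k) (MvPolynomial V k ⧸ I)))}

/-- The edge ideal of a simple graph `G`, generated by the monomials `x_i x_j` for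
edges `{i, j}` of `G`. -/
noncomputable def edgeIdeal (k : Type) [Field k] {V : Type} (G : SimpleGraph V) :
    Ideal (MvPolynomial V k) :=
  Ideal.span {p | ∃ i j, G.Adj i j ∧ p = X i * X j}

section LocalCohomology

open CategoryTheory Limits Opposite

namespace CochainComplex

variable {R : Type} [CommRing R] (K : CochainComplex (ModuleCat.{0} R) ℕ)

lemma homologyπ_eq_zero_iff (i : ℕ) (z : K.cycles i) :
    K.homologyπ i z = 0 ↔ ∃ (j : ℕ) (y : K.X j), K.d j i y = K.iCycles i z := by
  have hinj : Function.Injective (K.iCycles i) := (ModuleCat.mono_iff_injective _).1 inferInstance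
  constructor
  · intro h
    have := ShortComplex.exact_of_g_is_cokernel
      (ShortComplex.mk (K.toCycles ((ComplexShape.up ℕ).prev i) i) (K.homologyπ i) (by simp))
      (K.homologyIsCokernel _ i rfl)
    rw [ShortComplex.moduleCat_exact_iff] at this
    obtain ⟨y, hy⟩ := this z h
    refine ⟨_, y, ?_⟩
    rw [← hy]
    simp [← ConcreteCategory.comp_apply]
  · rintro ⟨j, y, hy⟩
    have : K.toCycles j i y = z := by
      apply hinj
      rw [← hy]
      simp [← ConcreteCategory.comp_apply]
    rw [← this]
    simp [← ConcreteCategory.comp_apply]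

lemma exists_cycles_of_d_eq_zero (i : ℕ) (x : K.X i) (hx : K.d i (i + 1) x = 0) :
    ∃ z : K.cycles i, K.iCycles i z = x := by
  have := ShortComplex.exact_of_f_is_kernel
    (ShortComplex.mk (K.iCycles i) (K.d i (i + 1)) (by simp)) (K.cyclesIsKernel i (i + 1) (by simp))
  rw [ShortComplex.moduleCat_exact_iff] at this
  exact this x hx

end CochainComplex

lemma CategoryTheory.Iso.inv_comp_eq_comp_inv_of_hom {C : Type*} [Category* C] {A B A' B' : C}
    (e : A ≅ B) (e' : A' ≅ B') {f : A ⟶ A'} {g : B ⟶ B'} (h : f ≫ e'.hom = e.hom ≫ g) :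
    e.inv ≫ f = g ≫ e'.inv := by
  rw [Iso.inv_comp_eq, ← Category.assoc, ← h, Category.assoc, Iso.hom_inv_id, Category.comp_id]

lemma CategoryTheory.comp_eq_comp_of_squares {C : Type*} [Category* C] {A B D A' B' D' : C}
    {a : A ⟶ B} {b : B ⟶ D} {a' : A' ⟶ B'} {b' : B' ⟶ D'} {f : A ⟶ A'} {g : B ⟶ B'} {h : D ⟶ D'}
    (h₁ : f ≫ a' = a ≫ g) (h₂ : g ≫ b' = b ≫ h) : f ≫ a' ≫ b' = (a ≫ b) ≫ h := by
  rw [reassoc_of% h₁, h₂, Category.assoc]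

lemma HomologicalComplex.homologyUnop_inv_naturality {V ι : Type*} [Category* V] [Abelian V]
    {c : ComplexShape ι} {K L : HomologicalComplex Vᵒᵖ c} (φ : K ⟶ L) (i : ι) :
    (homologyMap φ i).unop ≫ (K.homologyUnop i).inv =
      (L.homologyUnop i).inv ≫
        homologyMap ((unopFunctor V c).map φ.op) i := by
  have h : homologyMap φ i ≫ (L.unop.homologyOp i).hom =
      (K.unop.homologyOp i).hom ≫ (homologyMap ((unopFunctor V c).map φ.op) i).op :=
    homologyOp_hom_naturality ((unopFunctor V c).map φ.op) i
  exact congrArg Quiver.Hom.unop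
    (CategoryTheory.Iso.inv_comp_eq_comp_inv_of_hom (K.unop.homologyOp i) (L.unop.homologyOp i) h)

namespace CategoryTheory.ProjectiveResolution

variable {R : Type} [CommRing R] {X X' : ModuleCat.{0} R}

/-- The map of complexes `Hom(K, Y) ⟶ Hom(L, Y)` induced by a chain map `L ⟶ K`. -/
noncomputable abbrev linearYonedaMap {K L : ChainComplex (ModuleCat.{0} R) ℕ} (G : L ⟶ K)
    (Y : ModuleCat.{0} R) : K.linearYonedaObj R Y ⟶ L.linearYonedaObj R Y :=
  (HomologicalComplex.unopFunctor _ _).map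
    ((((linearYoneda R (ModuleCat.{0} R)).obj Y).rightOp.mapHomologicalComplex _).map G).op

lemma isoExt_hom_naturality (P : ProjectiveResolution X) (P' : ProjectiveResolution X')
    (g : X' ⟶ X) (G : P'.complex ⟶ P.complex) (hG : G.f 0 ≫ P.π.f 0 = P'.π.f 0 ≫ g)
    (i : ℕ) (Y : ModuleCat.{0} R) :
    ((Ext R (ModuleCat.{0} R) i).map g.op).app Y ≫ (P'.isoExt i Y).hom =
      (P.isoExt i Y).hom ≫ HomologicalComplex.homologyMap
        (linearYonedaMap G Y) i := by
  let F := ((linearYoneda R (ModuleCat.{0} R)).obj Y).rightOp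
  have h : ((F.leftDerived i).map g).unop ≫ (P'.isoLeftDerivedObj F i).inv.unop =
      (P.isoLeftDerivedObj F i).inv.unop ≫
        (HomologicalComplex.homologyMap ((F.mapHomologicalComplex _).map G) i).unop :=
    congrArg Quiver.Hom.unop (ProjectiveResolution.isoLeftDerivedObj_inv_naturality g P' P G hG F i)
  exact comp_eq_comp_of_squares h
    (HomologicalComplex.homologyUnop_inv_naturality ((F.mapHomologicalComplex _).map G) i)

variable {Y : ModuleCat.{0} R}

/-- `Represents P i φ e` says that the cocycle `φ` represents the class `e`. -/
def Represents (P : ProjectiveResolution X) (i : ℕ) (φ : P.complex.X i ⟶ Y)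
    (e : ((Ext R (ModuleCat.{0} R) i).obj (op X)).obj Y) : Prop :=
  ∃ z : (P.complex.linearYonedaObj R Y).cycles i,
    (P.complex.linearYonedaObj R Y).iCycles i z = φ ∧
      (P.isoExt i Y).hom e = (P.complex.linearYonedaObj R Y).homologyπ i z

lemma Represents.cocycle {P : ProjectiveResolution X} {i : ℕ} {φ : P.complex.X i ⟶ Y}
    {e : ((Ext R (ModuleCat.{0} R) i).obj (op X)).obj Y} (h : P.Represents i φ e) :
    P.complex.d (i + 1) i ≫ φ = 0 := by
  obtain ⟨z, rfl, -⟩ := h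
  have := congrArg (fun t => t z) (congrArg ModuleCat.Hom.hom
    ((P.complex.linearYonedaObj R Y).iCycles_d i (i + 1)))
  exact this

lemma exists_represents (P : ProjectiveResolution X) (i : ℕ)
    (e : ((Ext R (ModuleCat.{0} R) i).obj (op X)).obj Y) : ∃ φ, P.Represents i φ e := by
  obtain ⟨z, hz⟩ := (ModuleCat.epi_iff_surjective
    ((P.complex.linearYonedaObj R Y).homologyπ i)).1 inferInstance ((P.isoExt i Y).hom e)
  exact ⟨_, z, rfl, hz.symm⟩

lemma exists_represented (P : ProjectiveResolution X) (i : ℕ) (φ : P.complex.X i ⟶ Y)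
    (h : P.complex.d (i + 1) i ≫ φ = 0) : ∃ e, P.Represents i φ e := by
  obtain ⟨z, hz⟩ := (P.complex.linearYonedaObj R Y).exists_cycles_of_d_eq_zero i φ h
  exact ⟨(P.isoExt i Y).inv ((P.complex.linearYonedaObj R Y).homologyπ i z), z, hz, by simp⟩

lemma Represents.eq_zero_iff {P : ProjectiveResolution X} {i : ℕ} {φ : P.complex.X i ⟶ Y}
    {e : ((Ext R (ModuleCat.{0} R) i).obj (op X)).obj Y} (h : P.Represents i φ e) :
    e = 0 ↔ ∃ (j : ℕ) (ψ : P.complex.X j ⟶ Y), P.complex.d i j ≫ ψ = φ := by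
  obtain ⟨z, rfl, hz⟩ := h
  have hinj : Function.Injective (P.isoExt (R := R) i Y).hom :=
    (ModuleCat.mono_iff_injective _).1 inferInstance
  refine Iff.trans ?_ ((P.complex.linearYonedaObj R Y).homologyπ_eq_zero_iff i z)
  rw [← hz, ← map_zero (P.isoExt i Y).hom.hom]
  exact hinj.eq_iff.symm

lemma Represents.map {P : ProjectiveResolution X} {i : ℕ} {φ : P.complex.X i ⟶ Y}
    {e : ((Ext R (ModuleCat.{0} R) i).obj (op X)).obj Y} (h : P.Represents i φ e)
    (P' : ProjectiveResolution X') (g : X' ⟶ X) (G : P'.complex ⟶ P.complex)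
    (hG : G.f 0 ≫ P.π.f 0 = P'.π.f 0 ≫ g) :
    P'.Represents i (G.f i ≫ φ) (((Ext R (ModuleCat.{0} R) i).map g.op).app Y e) := by
  obtain ⟨z, rfl, hz⟩ := h
  refine ⟨HomologicalComplex.cyclesMap (linearYonedaMap G Y) i z, ?_, ?_⟩
  · exact congrArg (fun t => t z) (congrArg ModuleCat.Hom.hom
      (HomologicalComplex.cyclesMap_i (linearYonedaMap G Y) i))
  · have h1 := congrArg (fun t => t e) (congrArg ModuleCat.Hom.hom
      (isoExt_hom_naturality P P' g G hG i Y))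
    have h2 := congrArg (fun t => t z) (congrArg ModuleCat.Hom.hom
      (HomologicalComplex.homologyπ_naturality (linearYonedaMap G Y) i))
    refine h1.trans (Eq.trans ?_ h2)
    exact congrArg _ hz

end CategoryTheory.ProjectiveResolution

namespace localCohomology

open ProjectiveResolution

variable {R : Type} [CommRing R] (m : Ideal R) (M : ModuleCat.{0} R)

/-- A projective resolution of `R ⧸ m ^ t`. -/
noncomputable abbrev powRes (t : ℕᵒᵖ) :
    ProjectiveResolution ((ringModIdeals (idealPowersDiagram m)).obj t) :=
  projectiveResolution _

variable {m M}

/-- A chain map lifting the projection `R ⧸ m ^ t' ⟶ R ⧸ m ^ t`. -/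
def IsLift {t t' : ℕᵒᵖ} (G : (powRes m t').complex ⟶ (powRes m t).complex) : Prop :=
  ∃ g : t' ⟶ t, G.f 0 ≫ (powRes m t).π.f 0 =
    (powRes m t').π.f 0 ≫ (ringModIdeals (idealPowersDiagram m)).map g

lemma exists_isLift {t t' : ℕᵒᵖ} (g : t' ⟶ t) :
    ∃ G : (powRes m t').complex ⟶ (powRes m t).complex, G.f 0 ≫ (powRes m t).π.f 0 =
      (powRes m t').π.f 0 ≫ (ringModIdeals (idealPowersDiagram m)).map g :=
  ⟨_, ProjectiveResolution.lift_commutes_zero _ _ _⟩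

lemma IsLift.comp {t t' t'' : ℕᵒᵖ} {G : (powRes m t').complex ⟶ (powRes m t).complex}
    {G' : (powRes m t'').complex ⟶ (powRes m t').complex} (h : IsLift G) (h' : IsLift G') :
    IsLift (G' ≫ G) := by
  obtain ⟨g, hg⟩ := h
  obtain ⟨g', hg'⟩ := h'
  refine ⟨g' ≫ g, ?_⟩
  rw [Functor.map_comp]
  exact (comp_eq_comp_of_squares hg'.symm hg.symm).symm

/-- Being a coboundary in the complex `Hom(K, M)`. -/
def IsCoboundary {K : ChainComplex (ModuleCat.{0} R) ℕ} {i : ℕ} (φ : K.X i ⟶ M) : Prop :=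
  ∃ (j : ℕ) (ψ : K.X j ⟶ M), K.d i j ≫ ψ = φ

/-- The class of a cocycle vanishes after passing to a higher power of `m`. -/
def EventuallyCoboundary {t : ℕᵒᵖ} {i : ℕ} (φ : (powRes m t).complex.X i ⟶ M) : Prop :=
  ∃ (t' : ℕᵒᵖ) (G : (powRes m t').complex ⟶ (powRes m t).complex),
    IsLift G ∧ IsCoboundary (G.f i ≫ φ)

variable (m M) in
/-- An elementary formulation of the vanishing of local cohomology. -/
def Vanishes (i : ℕ) : Prop :=
  ∀ (t : ℕᵒᵖ) (φ : (powRes m t).complex.X i ⟶ M), (powRes m t).complex.d (i + 1) i ≫ φ = 0 →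
    EventuallyCoboundary φ

lemma subsingleton_iff_vanishes (i : ℕ) :
    Subsingleton ((localCohomology m i).obj M) ↔ Vanishes m M i := by
  let D := diagram (idealPowersDiagram m) i
  let c : Cocone (D ⋙ (evaluation _ _).obj M) :=
    ((evaluation _ _).obj M).mapCocone (colimit.cocone D)
  have hc : IsColimit c := isColimitOfPreserves _ (colimit.isColimit D)
  change Subsingleton c.pt ↔ _
  constructor
  · intro hs t φ hφ
    obtain ⟨e, he⟩ := exists_represented (powRes m t) i φ hφ
    obtain ⟨k, f, g, hfg⟩ := Concrete.isColimit_exists_of_rep_eq _ hc (i := op t) (j := op t) e 0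
      (hs.elim _ _)
    obtain ⟨G, hG⟩ := exists_isLift (m := m) f.unop
    refine ⟨k.unop, G, ⟨_, hG⟩, ?_⟩
    refine ((he.map (powRes m k.unop) _ G hG).eq_zero_iff).1 ?_
    refine hfg.trans ?_
    exact map_zero _
  · intro h
    refine subsingleton_of_forall_eq 0 fun x => ?_
    obtain ⟨t, e, rfl⟩ := Concrete.isColimit_exists_rep _ hc x
    obtain ⟨φ, hφ⟩ := exists_represents (powRes m t.unop) i e
    obtain ⟨t', G, ⟨g, hG⟩, hcob⟩ := h _ φ hφ.cocycle
    have h0 := ((hφ.map (powRes m t') _ G hG).eq_zero_iff).2 hcob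
    have := Concrete.isColimit_rep_eq_of_exists _ (D := c) (i := t) (j := t) e 0
      ⟨op t', g.op, g.op, h0.trans (map_zero _).symm⟩
    exact this.trans (map_zero _)

end localCohomology

namespace localCohomology

open ProjectiveResolution

variable {R : Type} [CommRing R] {m : Ideal R} {M N : ModuleCat.{0} R}

section Coboundary

variable {K L : ChainComplex (ModuleCat.{0} R) ℕ} {i : ℕ}

lemma IsCoboundary.eq_zero {φ : K.X 0 ⟶ M} (h : IsCoboundary φ) : φ = 0 := by
  obtain ⟨j, ψ, rfl⟩ := h
  rw [K.shape 0 j (by simp), zero_comp]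

lemma IsCoboundary.exists_succ {φ : K.X (i + 1) ⟶ M} (h : IsCoboundary φ) :
    ∃ ψ : K.X i ⟶ M, K.d (i + 1) i ≫ ψ = φ := by
  obtain ⟨j, ψ, rfl⟩ := h
  by_cases hj : j = i
  · subst hj
    exact ⟨ψ, rfl⟩
  · exact ⟨0, by rw [K.shape (i + 1) j (by simpa using hj), zero_comp, comp_zero]⟩

lemma IsCoboundary.zero : IsCoboundary (0 : K.X i ⟶ M) := ⟨0, 0, by simp⟩

lemma IsCoboundary.add {φ ψ : K.X i ⟶ M} (h : IsCoboundary φ) (h' : IsCoboundary ψ) :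
    IsCoboundary (φ + ψ) := by
  cases i with
  | zero => rw [h.eq_zero, h'.eq_zero, add_zero]; exact .zero
  | succ i =>
    obtain ⟨a, rfl⟩ := h.exists_succ
    obtain ⟨b, rfl⟩ := h'.exists_succ
    exact ⟨i, a + b, by rw [Preadditive.comp_add]⟩

lemma IsCoboundary.precomp {φ : K.X i ⟶ M} (h : IsCoboundary φ) (G : L ⟶ K) :
    IsCoboundary (G.f i ≫ φ) := by
  obtain ⟨j, ψ, rfl⟩ := h
  exact ⟨j, G.f j ≫ ψ, by rw [← G.comm_assoc]⟩

lemma IsCoboundary.postcomp {φ : K.X i ⟶ M} (h : IsCoboundary φ) (f : M ⟶ N) :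
    IsCoboundary (φ ≫ f) := by
  obtain ⟨j, ψ, rfl⟩ := h
  exact ⟨j, ψ ≫ f, by rw [Category.assoc]⟩

end Coboundary

lemma EventuallyCoboundary.of_precomp {t t' : ℕᵒᵖ} {i : ℕ}
    {G : (powRes m t').complex ⟶ (powRes m t).complex} (hG : IsLift G)
    {φ : (powRes m t).complex.X i ⟶ M} (h : EventuallyCoboundary (G.f i ≫ φ)) :
    EventuallyCoboundary φ := by
  obtain ⟨t'', G', hG', h⟩ := h
  exact ⟨t'', G' ≫ G, hG.comp hG', by
    rwa [HomologicalComplex.comp_f, Category.assoc]⟩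

variable {S : ShortComplex (ModuleCat.{0} R)}

lemma eventuallyCoboundary_of_postcomp_mono (hS : S.ShortExact) {t : ℕᵒᵖ} {i : ℕ}
    (hv : ∀ k, k + 1 = i → Vanishes m S.X₃ k)
    (φ : (powRes m t).complex.X i ⟶ S.X₁) (hφ : IsCoboundary (φ ≫ S.f)) :
    EventuallyCoboundary φ := by
  have := hS.mono_f
  have := hS.epi_g
  cases i with
  | zero =>
    obtain ⟨G, hG⟩ := exists_isLift (m := m) (𝟙 t)
    have h0 : φ = 0 := by rw [← cancel_mono S.f, hφ.eq_zero, zero_comp]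
    exact ⟨t, G, ⟨_, hG⟩, by rw [h0, comp_zero]; exact .zero⟩
  | succ i =>
    obtain ⟨ψ, hψ⟩ := hφ.exists_succ
    obtain ⟨t', G, hG, j, θ, hθ⟩ := hv i rfl t (ψ ≫ S.g) (by
      rw [reassoc_of% hψ, S.zero, comp_zero])
    refine ⟨t', G, hG, ?_⟩
    let θ' := Projective.factorThru θ S.g
    have hθ' : θ' ≫ S.g = θ := Projective.factorThru_comp _ _
    have hk : (G.f i ≫ ψ - (powRes m t').complex.d i j ≫ θ') ≫ S.g = 0 := by
      rw [Preadditive.sub_comp, Category.assoc, Category.assoc, hθ', hθ, sub_self]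
    refine ⟨i, hS.exact.lift _ hk, ?_⟩
    rw [← cancel_mono S.f, Category.assoc, hS.exact.lift_f, Preadditive.comp_sub,
      HomologicalComplex.d_comp_d_assoc, zero_comp, sub_zero, ← G.comm_assoc, hψ, Category.assoc]

lemma Vanishes.of_X₁_X₃ (hS : S.ShortExact) {i : ℕ} (h₁ : Vanishes m S.X₁ i)
    (h₃ : Vanishes m S.X₃ i) : Vanishes m S.X₂ i := by
  have := hS.mono_f
  have := hS.epi_g
  intro t φ hφ
  obtain ⟨t', G, hG, j, θ, hθ⟩ := h₃ t (φ ≫ S.g) (by rw [reassoc_of% hφ, zero_comp])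
  let θ' := Projective.factorThru θ S.g
  have hθ' : θ' ≫ S.g = θ := Projective.factorThru_comp _ _
  have hk : (G.f i ≫ φ - (powRes m t').complex.d i j ≫ θ') ≫ S.g = 0 := by
    rw [Preadditive.sub_comp, Category.assoc, Category.assoc, hθ', hθ, sub_self]
  obtain ⟨t'', G', hG', hcob⟩ := h₁ t' (hS.exact.lift _ hk) (by
    rw [← cancel_mono S.f, Category.assoc, hS.exact.lift_f, Preadditive.comp_sub,
      HomologicalComplex.d_comp_d_assoc, zero_comp, sub_zero, ← G.comm_assoc, hφ, comp_zero,
      zero_comp])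
  refine .of_precomp hG ⟨t'', G', hG', ?_⟩
  have e : G'.f i ≫ G.f i ≫ φ = (G'.f i ≫ hS.exact.lift _ hk) ≫ S.f +
      G'.f i ≫ (powRes m t').complex.d i j ≫ θ' := by
    rw [Category.assoc, hS.exact.lift_f, ← Preadditive.comp_add, sub_add_cancel]
  rw [e]
  exact (hcob.postcomp _).add (IsCoboundary.precomp ⟨j, θ', rfl⟩ G')

lemma Vanishes.of_X₂_X₃ (hS : S.ShortExact) {i : ℕ} (h₂ : Vanishes m S.X₂ i)
    (h₃ : ∀ k, k + 1 = i → Vanishes m S.X₃ k) : Vanishes m S.X₁ i := by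
  intro t φ hφ
  obtain ⟨t', G, hG, hcob⟩ := h₂ t (φ ≫ S.f) (by rw [reassoc_of% hφ, zero_comp])
  refine .of_precomp hG (eventuallyCoboundary_of_postcomp_mono hS h₃ _ ?_)
  rwa [Category.assoc]

lemma Vanishes.of_X₂_X₁ (hS : S.ShortExact) {i : ℕ} (h₂ : Vanishes m S.X₂ i)
    (h₁ : Vanishes m S.X₁ (i + 1)) : Vanishes m S.X₃ i := by
  have := hS.mono_f
  have := hS.epi_g
  intro t φ hφ
  let φ' := Projective.factorThru φ S.g
  have hφ' : φ' ≫ S.g = φ := Projective.factorThru_comp _ _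
  have hk : ((powRes m t).complex.d (i + 1) i ≫ φ') ≫ S.g = 0 := by
    rw [Category.assoc, hφ', hφ]
  obtain ⟨t', G, hG, hcob⟩ := h₁ t (hS.exact.lift _ hk) (by
    rw [← cancel_mono S.f, Category.assoc, hS.exact.lift_f,
      HomologicalComplex.d_comp_d_assoc, zero_comp, zero_comp])
  obtain ⟨ψ, hψ⟩ := hcob.exists_succ
  obtain ⟨t'', G', hG', hcob'⟩ := h₂ t' (G.f i ≫ φ' - ψ ≫ S.f) (by
    rw [Preadditive.comp_sub, reassoc_of% hψ, hS.exact.lift_f, G.comm_assoc, sub_self])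
  refine .of_precomp hG ⟨t'', G', hG', ?_⟩
  have := hcob'.postcomp S.g
  rwa [Category.assoc, Preadditive.sub_comp, Category.assoc, Category.assoc, S.zero, comp_zero,
    sub_zero, hφ'] at this

lemma IsCoboundary.eventually {t : ℕᵒᵖ} {i : ℕ} {φ : (powRes m t).complex.X i ⟶ M}
    (h : IsCoboundary φ) : EventuallyCoboundary φ := by
  obtain ⟨G, hG⟩ := exists_isLift (m := m) (𝟙 t)
  exact ⟨t, G, ⟨_, hG⟩, h.precomp G⟩

/-- A power of an element of `m` annihilates each class. -/
lemma exists_isCoboundary_pow_smul {f : R} (hf : f ∈ m) (t : ℕᵒᵖ) {i : ℕ}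
    (φ : (powRes m t).complex.X i ⟶ M) (hφ : (powRes m t).complex.d (i + 1) i ≫ φ = 0) :
    ∃ s : ℕ, IsCoboundary (f ^ s • φ) := by
  refine ⟨t.unop, ?_⟩
  let G : (powRes m t).complex ⟶ (powRes m t).complex := f ^ t.unop • 𝟙 _
  have hG : G ≫ (powRes m t).π = 0 := by
    refine HomologicalComplex.to_single_hom_ext ?_
    have h0 : ∀ y : R ⧸ m ^ t.unop, f ^ t.unop • y = 0 := by
      intro y
      obtain ⟨y, rfl⟩ := Ideal.Quotient.mk_surjective y
      rw [← Ideal.Quotient.mk_eq_mk, ← Submodule.Quotient.mk_smul,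
        Submodule.Quotient.mk_eq_zero, smul_eq_mul]
      exact Ideal.mul_mem_right _ _ (Ideal.pow_mem_pow hf _)
    ext x
    refine Eq.trans ?_ (h0 ((powRes m t).π.f 0 x))
    exact map_smul ((powRes m t).π.f 0).hom _ _
  have h := liftHomotopyZero G hG
  have hc := h.comm i
  have hG' : f ^ t.unop • φ = G.f i ≫ φ := by simp [G]
  rw [hG', hc]
  refine ⟨(ComplexShape.down ℕ).next i, h.hom _ i ≫ φ, ?_⟩
  rw [HomologicalComplex.zero_f, add_zero, Preadditive.add_comp,
    prevD_eq h.hom (show (ComplexShape.down ℕ).Rel (i + 1) i by simp), Category.assoc, hφ,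
    comp_zero, add_zero, ← Category.assoc]
  rfl

lemma Vanishes.of_regular {f : R} (hf : f ∈ m) {p : M ⟶ N} {w : (f • 𝟙 M) ≫ p = 0}
    (hS : (ShortComplex.mk (f • 𝟙 M) p w).ShortExact) {i : ℕ}
    (h₃ : ∀ k, k + 1 = i → Vanishes m N k) : Vanishes m M i := by
  have key : ∀ (s : ℕ) (t : ℕᵒᵖ) (φ : (powRes m t).complex.X i ⟶ M),
      IsCoboundary (f ^ s • φ) → EventuallyCoboundary φ := by
    intro s
    induction s with
    | zero =>
      intro t φ h
      rw [pow_zero, one_smul] at h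
      exact h.eventually
    | succ s ih =>
      intro t φ h
      obtain ⟨t', G, hG, hcob⟩ := eventuallyCoboundary_of_postcomp_mono hS h₃ (f ^ s • φ) (by
        rw [CategoryTheory.Linear.comp_smul, Category.comp_id, smul_smul, ← pow_succ']
        exact h)
      rw [CategoryTheory.Linear.comp_smul] at hcob
      exact .of_precomp hG (ih t' _ hcob)
  intro t φ hφ
  obtain ⟨s, hs⟩ := exists_isCoboundary_pow_smul hf t φ hφ
  exact key s t φ hs

end localCohomology

namespace localCohomology

variable {R : Type} [CommRing R] {m : Ideal R}

/-- The quotient of a commutative ring by an ideal, as an object of the category of modules. -/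
abbrev quot (J : Ideal R) : ModuleCat.{0} R := ModuleCat.of R (R ⧸ J)

/-- The projection of the quotient by an ideal onto the quotient by a larger ideal. -/
abbrev quotMap {J J' : Ideal R} (h : J ≤ J') : quot J ⟶ quot J' :=
  ModuleCat.ofHom (Submodule.factor h)

lemma shortExact_smul_quotMap {J : Ideal R} {f : R} (h : ∀ g, f * g ∈ J → g ∈ J) :
    ∃ w, (ShortComplex.mk (f • 𝟙 (quot J))
      (quotMap (le_sup_left : J ≤ J ⊔ Ideal.span {f})) w).ShortExact := by
  refine ⟨?_, { exact := ?_, mono_f := ?_, epi_g := ?_ }⟩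
  · refine ModuleCat.hom_ext (LinearMap.ext fun x => ?_)
    obtain ⟨x, rfl⟩ := Submodule.Quotient.mk_surjective _ x
    refine (Submodule.Quotient.mk_eq_zero _).2 (Ideal.mem_sup_right ?_)
    exact Ideal.mul_mem_right _ _ (Ideal.mem_span_singleton_self f)
  · rw [ShortComplex.moduleCat_exact_iff]
    intro x hx
    obtain ⟨x, rfl⟩ := Submodule.Quotient.mk_surjective _ x
    obtain ⟨a, ha, b, hb, hab⟩ := Submodule.mem_sup.1 ((Submodule.Quotient.mk_eq_zero _).1 hx)
    obtain ⟨c, rfl⟩ := Ideal.mem_span_singleton'.1 hb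
    refine ⟨Submodule.Quotient.mk c, (Submodule.Quotient.eq J).2 ?_⟩
    change f * c - x ∈ J
    rw [← show a + c * f = x from hab, mul_comm, sub_add_cancel_right]
    exact neg_mem ha
  · refine (ModuleCat.mono_iff_injective _).2 ((injective_iff_map_eq_zero _).2 fun x hx => ?_)
    obtain ⟨x, rfl⟩ := Submodule.Quotient.mk_surjective _ x
    exact (Submodule.Quotient.mk_eq_zero _).2
      (h _ ((Submodule.Quotient.mk_eq_zero J (x := f * x)).1 hx))
  · exact (ModuleCat.epi_iff_surjective _).2 (Submodule.factor_surjective (le_sup_left : J ≤ _))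

lemma shortExact_inl_snd (M N : ModuleCat.{0} R) :
    (ShortComplex.mk (X₁ := M) (X₂ := ModuleCat.of R (M × N)) (X₃ := N)
      (ModuleCat.ofHom (LinearMap.inl R M N))
      (ModuleCat.ofHom (LinearMap.snd R M N)) (by ext; rfl)).ShortExact := by
  refine { exact := ?_, mono_f := ?_, epi_g := ?_ }
  · rw [ShortComplex.moduleCat_exact_iff]
    rintro ⟨x, y⟩ (rfl : y = 0)
    exact ⟨x, rfl⟩
  · exact (ModuleCat.mono_iff_injective _).2 LinearMap.inl_injective
  · exact (ModuleCat.epi_iff_surjective _).2 LinearMap.snd_surjective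

/-- The Mayer–Vietoris sequence of two ideals. -/
lemma exists_shortExact_inf_sup (P Q : Ideal R) :
    ∃ (f : quot (P ⊓ Q) ⟶ ModuleCat.of R (quot P × quot Q))
      (g : ModuleCat.of R (quot P × quot Q) ⟶ quot (P ⊔ Q)) (w : f ≫ g = 0),
      (ShortComplex.mk f g w).ShortExact := by
  refine ⟨ModuleCat.ofHom
      ((Submodule.factor inf_le_left).prod (Submodule.factor inf_le_right)),
    ModuleCat.ofHom
      ((Submodule.factor (le_sup_left : P ≤ P ⊔ Q)).coprod
        (-(Submodule.factor (le_sup_right : Q ≤ P ⊔ Q)))), ?_,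
    { exact := ?_, mono_f := ?_, epi_g := ?_ }⟩
  · refine ModuleCat.hom_ext (LinearMap.ext fun x => ?_)
    obtain ⟨x, rfl⟩ := Submodule.Quotient.mk_surjective _ x
    exact add_neg_cancel (Submodule.Quotient.mk x : R ⧸ (P ⊔ Q))
  · rw [ShortComplex.moduleCat_exact_iff]
    rintro ⟨x, y⟩ hx
    obtain ⟨x, rfl⟩ := Submodule.Quotient.mk_surjective _ x
    obtain ⟨y, rfl⟩ := Submodule.Quotient.mk_surjective _ y
    have hxy : x - y ∈ P ⊔ Q := by
      refine (Submodule.Quotient.eq _).1 ?_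
      exact add_neg_eq_zero.1 hx
    obtain ⟨a, ha, b, hb, hab⟩ := Submodule.mem_sup.1 hxy
    refine ⟨Submodule.Quotient.mk (x - a), Prod.ext ?_ ?_⟩
    · refine (Submodule.Quotient.eq P).2 ?_
      change x - a - x ∈ P
      rw [sub_sub_cancel_left]
      exact neg_mem ha
    · refine (Submodule.Quotient.eq Q).2 ?_
      change x - a - y ∈ Q
      convert hb using 1
      linear_combination -hab
  · refine (ModuleCat.mono_iff_injective _).2 ((injective_iff_map_eq_zero _).2 fun x hx => ?_)
    obtain ⟨x, rfl⟩ := Submodule.Quotient.mk_surjective _ x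
    obtain ⟨h1, h2⟩ := Prod.ext_iff.1 hx
    exact (Submodule.Quotient.mk_eq_zero _).2
      ⟨(Submodule.Quotient.mk_eq_zero P).1 h1, (Submodule.Quotient.mk_eq_zero Q).1 h2⟩
  · refine (ModuleCat.epi_iff_surjective _).2 fun x => ?_
    obtain ⟨x, rfl⟩ := Submodule.Quotient.mk_surjective _ x
    refine ⟨(Submodule.Quotient.mk x, 0), ?_⟩
    change Submodule.Quotient.mk x + -(Submodule.factor (le_sup_right : Q ≤ P ⊔ Q) 0) = _
    rw [map_zero, neg_zero, add_zero]

lemma Vanishes.inf {P Q : Ideal R} {i : ℕ} (hP : Vanishes m (quot P) i)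
    (hQ : Vanishes m (quot Q) i) (hPQ : ∀ k, k + 1 = i → Vanishes m (quot (P ⊔ Q)) k) :
    Vanishes m (quot (P ⊓ Q)) i := by
  obtain ⟨f, g, w, hS⟩ := exists_shortExact_inf_sup P Q
  exact Vanishes.of_X₂_X₃ hS (Vanishes.of_X₁_X₃ (shortExact_inl_snd _ _) hP hQ) hPQ

/-- If the zeroth local cohomology vanishes, no nonzero element is annihilated by `m`. -/
lemma Vanishes.eq_zero_of_forall_smul {M : ModuleCat.{0} R} (h : Vanishes m M 0) {x : M}
    (hx : ∀ r ∈ m, r • x = 0) : x = 0 := by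
  let t : ℕᵒᵖ := op 1
  have hle : m ^ t.unop ≤ LinearMap.ker (LinearMap.toSpanSingleton R M x) := by
    intro r hr
    rw [LinearMap.mem_ker, LinearMap.toSpanSingleton_apply]
    exact hx r (by simpa [t] using hr)
  let q : (ringModIdeals (idealPowersDiagram m)).obj t ⟶ M :=
    ModuleCat.ofHom (Submodule.liftQ (m ^ t.unop) (LinearMap.toSpanSingleton R M x) hle)
  let π (s : ℕᵒᵖ) : (powRes m s).complex.X 0 ⟶ (ringModIdeals (idealPowersDiagram m)).obj s :=
    (powRes m s).π.f 0
  have hd (s : ℕᵒᵖ) : (powRes m s).complex.d (0 + 1) 0 ≫ π s = 0 :=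
    (powRes m s).complex_d_comp_π_f_zero
  have hπ (s : ℕᵒᵖ) : Epi (π s) := inferInstanceAs (Epi ((powRes m s).π.f 0))
  obtain ⟨t', G, ⟨g, hG⟩, hcob⟩ := h t (π t ≫ q) (by rw [← Category.assoc, hd, zero_comp])
  replace hG : G.f 0 ≫ π t = π t' ≫ (ringModIdeals (idealPowersDiagram m)).map g := hG
  have h0 := hcob.eq_zero
  rw [← Category.assoc, hG, Category.assoc] at h0
  have hq : (ringModIdeals (idealPowersDiagram m)).map g ≫ q = 0 := by
    rw [← cancel_epi (π t'), comp_zero]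
    exact h0
  have := congrArg (fun φ => φ.hom (Submodule.Quotient.mk (1 : R))) hq
  exact (one_smul R x).symm.trans this

/-- Some local cohomology module of a nonzero cyclic module supported at `m` is nonzero. -/
theorem exists_not_vanishes [IsNoetherianRing R] (hm : m ≠ ⊤) (J : Ideal R) (hJ : J ≤ m) :
    ∃ i, ¬ Vanishes m (quot J) i := by
  induction J using WellFoundedGT.induction with
  | ind J ih =>
  by_contra! hv
  obtain ⟨f, hfm, hf⟩ : ∃ f ∈ m, ∀ g, f * g ∈ J → g ∈ J := by
    by_contra! hcon
    have hsub : (m : Set R) ⊆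
        ⋃ p ∈ ((associatedPrimes.finite R (R ⧸ J)).toFinset : Set (Ideal R)), (p : Set R) := by
      rw [Set.Finite.coe_toFinset, biUnion_associatedPrimes_eq_zero_divisors]
      intro f hf
      obtain ⟨g, hg, hgJ⟩ := hcon f hf
      exact ⟨Submodule.Quotient.mk g, fun h => hgJ ((Submodule.Quotient.mk_eq_zero _).1 h),
        (Submodule.Quotient.mk_eq_zero J).2 hg⟩
    rw [Ideal.subset_union_prime ⊥ ⊥ (fun p hp _ _ => by
      simp only [Set.Finite.mem_toFinset] at hp
      exact hp.isPrime)] at hsub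
    obtain ⟨p, hp, hmp⟩ := hsub
    simp only [Set.Finite.mem_toFinset] at hp
    obtain ⟨hpp, x, hx⟩ := isAssociatedPrime_iff.1 hp
    have hx0 : x = 0 := (hv 0).eq_zero_of_forall_smul fun r hr => by
      have := hmp hr
      rw [hx] at this
      exact Submodule.mem_colon_singleton.1 this
    subst hx0
    exact hpp.ne_top (by rw [hx]; exact Ideal.eq_top_of_isUnit_mem _ (by simp) isUnit_one)
  obtain ⟨w, hS⟩ := shortExact_smul_quotMap hf
  have hfJ : f ∉ J := fun h => hm <| (Ideal.eq_top_iff_one _).2 <| hJ <| hf 1 (by simpa using h)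
  obtain ⟨i, hi⟩ := ih (J ⊔ Ideal.span {f})
    (left_lt_sup.2 fun h => hfJ (h (Ideal.mem_span_singleton_self f)))
    (sup_le hJ ((Ideal.span_singleton_le_iff_mem _).2 hfm))
  exact hi (Vanishes.of_X₂_X₁ hS (hv i) (hv (i + 1)))

end localCohomology

end LocalCohomology

section MonomialIdeals

variable (k : Type) [Field k] {V : Type}

/-- The ideal generated by the monomials with exponents in `E`. -/
noncomputable def monomialIdeal (E : Set (V →₀ ℕ)) : Ideal (MvPolynomial V k) :=
  Ideal.span ((fun s => monomial s (1 : k)) '' E)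

variable {k}

lemma mem_monomialIdeal {E : Set (V →₀ ℕ)} {f : MvPolynomial V k} :
    f ∈ monomialIdeal k E ↔ ∀ u ∈ f.support, ∃ s ∈ E, s ≤ u :=
  mem_ideal_span_monomial_image

lemma monomialIdeal_le {E E' : Set (V →₀ ℕ)} (h : ∀ s ∈ E, ∃ s' ∈ E', s' ≤ s) :
    monomialIdeal k E ≤ monomialIdeal k E' := fun f hf => by
  rw [mem_monomialIdeal] at hf ⊢
  intro u hu
  obtain ⟨s, hs, hsu⟩ := hf u hu
  obtain ⟨s', hs', hle⟩ := h s hs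
  exact ⟨s', hs', hle.trans hsu⟩

lemma monomialIdeal_sup (E E' : Set (V →₀ ℕ)) :
    monomialIdeal k E ⊔ monomialIdeal k E' = monomialIdeal k (E ∪ E') := by
  rw [monomialIdeal, monomialIdeal, monomialIdeal, Set.image_union, Ideal.span_union]

lemma monomialIdeal_sup_span_X (E : Set (V →₀ ℕ)) (v : V) :
    monomialIdeal k E ⊔ Ideal.span {X v} = monomialIdeal k (E ∪ {Finsupp.single v 1}) := by
  rw [← monomialIdeal_sup]
  congr 1
  rw [monomialIdeal, Set.image_singleton]
  rfl

lemma monomialIdeal_sq (E : Set (V →₀ ℕ)) :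
    monomialIdeal k E ^ 2 = monomialIdeal k {u | ∃ s ∈ E, ∃ t ∈ E, s + t = u} := by
  rw [sq, monomialIdeal, Ideal.span_mul_span', monomialIdeal]
  congr 1
  ext f
  simp only [Set.mem_mul, Set.mem_image, Set.mem_ofPred_eq]
  constructor
  · rintro ⟨_, ⟨s, hs, rfl⟩, _, ⟨t, ht, rfl⟩, rfl⟩
    exact ⟨_, ⟨s, hs, t, ht, rfl⟩, by rw [monomial_mul, one_mul]⟩
  · rintro ⟨_, ⟨s, hs, t, ht, rfl⟩, rfl⟩
    exact ⟨_, ⟨s, hs, rfl⟩, _, ⟨t, ht, rfl⟩, by rw [monomial_mul, one_mul]⟩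

lemma mem_colon_monomialIdeal {E : Set (V →₀ ℕ)} {c : V →₀ ℕ} {f : MvPolynomial V k} :
    f ∈ Submodule.colon (monomialIdeal k E) (Ideal.span {monomial c (1 : k)}) ↔
      ∀ u ∈ f.support, ∃ s ∈ E, s ≤ u + c := by
  rw [Submodule.mem_colon_span_singleton, smul_eq_mul, mem_monomialIdeal]
  constructor
  · intro h u hu
    refine h (u + c) ?_
    rwa [mem_support_iff, coeff_mul_monomial, mul_one, ← mem_support_iff]
  · intro h u hu
    rw [mem_support_iff, coeff_mul_monomial'] at hu
    split_ifs at hu with hc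
    · rw [mul_one, ← mem_support_iff] at hu
      simpa [tsub_add_cancel_of_le hc] using h _ hu
    · exact absurd rfl hu

lemma maxHomIdeal_eq_monomialIdeal :
    maxHomIdeal k V = monomialIdeal k (Set.range fun v => Finsupp.single v 1) := by
  rw [maxHomIdeal, monomialIdeal, ← Set.range_comp]
  rfl

lemma maxHomIdeal_ne_top : maxHomIdeal k V ≠ ⊤ := by
  rw [Ne, Ideal.eq_top_iff_one, maxHomIdeal_eq_monomialIdeal, mem_monomialIdeal]
  intro h
  obtain ⟨_, ⟨v, rfl⟩, hv⟩ := h 0 (by simp)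
  have := hv v
  simp at this

lemma X_mem_maxHomIdeal (v : V) : (X v : MvPolynomial V k) ∈ maxHomIdeal k V :=
  Ideal.subset_span ⟨v, rfl⟩

lemma mem_monomialIdeal_of_X_mul_mem {E : Set (V →₀ ℕ)} {v : V} (hE : ∀ s ∈ E, s v = 0)
    (f : MvPolynomial V k) (hf : X v * f ∈ monomialIdeal k E) : f ∈ monomialIdeal k E := by
  rw [mem_monomialIdeal] at hf ⊢
  intro u hu
  obtain ⟨s, hs, hle⟩ := hf (Finsupp.single v 1 + u) (by
    rw [support_X_mul]
    exact Finset.mem_map_of_mem (addLeftEmbedding _) hu)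
  refine ⟨s, hs, fun w => ?_⟩
  by_cases hw : w = v
  · rw [hw, hE s hs]
    exact zero_le
  · simpa [Finsupp.single_apply, Ne.symm hw] using hle w

open localCohomology

lemma vanishes_monomialIdeal_of_forall_mem (T : Finset V) :
    ∀ (E : Set (V →₀ ℕ)), (∀ s ∈ E, ∀ v ∈ T, s v = 0) → ∀ i < T.card,
      Vanishes (maxHomIdeal k V) (quot (monomialIdeal k E)) i := by
  classical
  induction T using Finset.induction_on with
  | empty => intro E _ i hi; simp at hi
  | insert v T hv ih =>
    intro E hE i hi
    obtain ⟨w, hS⟩ := shortExact_smul_quotMap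
      (mem_monomialIdeal_of_X_mul_mem (k := k) fun s hs => hE s hs v (by simp))
    refine Vanishes.of_regular (X_mem_maxHomIdeal v) hS fun j hj => ?_
    rw [monomialIdeal_sup_span_X]
    refine ih _ ?_ j ?_
    · rintro s (hs | rfl) w hw
      · exact hE s hs w (Finset.mem_insert_of_mem hw)
      · exact Finsupp.single_eq_of_ne (by rintro rfl; exact hv hw)
    · rw [Finset.card_insert_of_notMem hv] at hi
      omega

/-- The depth of a monomial quotient is at least the number of variables that do not occur in the
generators. -/
lemma vanishes_monomialIdeal {n : ℕ} {v : Fin n → V} (hv : Function.Injective v)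
    {E : Set (V →₀ ℕ)} (hE : ∀ s ∈ E, ∀ j, s (v j) = 0) {i : ℕ} (hi : i < n) :
    Vanishes (maxHomIdeal k V) (quot (monomialIdeal k E)) i :=
  vanishes_monomialIdeal_of_forall_mem (Finset.univ.map ⟨v, hv⟩) E
    (fun s hs w hw => by
      obtain ⟨j, -, rfl⟩ := Finset.mem_map.1 hw
      exact hE s hs j) i (by simpa using hi)

lemma le_depthQuot [Finite V] {J : Ideal (MvPolynomial V k)} (hJ : J ≤ maxHomIdeal k V) {n : ℕ}
    (h : ∀ i < n, Vanishes (maxHomIdeal k V) (quot J) i) : n ≤ depthQuot k J := by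
  refine le_csInf ?_ fun i hi => ?_
  · obtain ⟨i, hi⟩ := exists_not_vanishes maxHomIdeal_ne_top J hJ
    exact ⟨i, not_subsingleton_iff_nontrivial.1 fun hs => hi ((subsingleton_iff_vanishes i).1 hs)⟩
  · by_contra! hlt
    exact not_subsingleton_iff_nontrivial.2 hi ((subsingleton_iff_vanishes i).2 (h i hlt))

section Bipartite

variable {d : ℕ}

/-- The exponent of `x_i`. -/
noncomputable abbrev xExp (i : Fin d) : Fin d ⊕ Fin d →₀ ℕ := Finsupp.single (Sum.inl i) 1

/-- The exponent of `y_j`. -/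
noncomputable abbrev yExp (j : Fin d) : Fin d ⊕ Fin d →₀ ℕ := Finsupp.single (Sum.inr j) 1

/-- The exponents of the edges `x_i y_j` of a bipartite graph with adjacency relation `r`. -/
def edgeExps (r : Fin d → Fin d → Prop) : Set (Fin d ⊕ Fin d →₀ ℕ) :=
  {u | ∃ i j, r i j ∧ u = xExp i + yExp j}

/-- The exponents of the variables `x_i` with `i` in a given set. -/
def xExps (A : Fin d → Prop) : Set (Fin d ⊕ Fin d →₀ ℕ) := {u | ∃ i, A i ∧ u = xExp i}

/-- The exponents of the variables `y_j`. -/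
def yExps (d : ℕ) : Set (Fin d ⊕ Fin d →₀ ℕ) := Set.range yExp

lemma xExp_le {i : Fin d} {u : Fin d ⊕ Fin d →₀ ℕ} : xExp i ≤ u ↔ 1 ≤ u (Sum.inl i) :=
  Finsupp.single_le_iff

lemma yExp_le {j : Fin d} {u : Fin d ⊕ Fin d →₀ ℕ} : yExp j ≤ u ↔ 1 ≤ u (Sum.inr j) :=
  Finsupp.single_le_iff

lemma xExp_add_yExp_le {i j : Fin d} {u : Fin d ⊕ Fin d →₀ ℕ} :
    xExp i + yExp j ≤ u ↔ 1 ≤ u (Sum.inl i) ∧ 1 ≤ u (Sum.inr j) := by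
  rw [← xExp_le, ← yExp_le]
  refine ⟨fun h => ⟨le_self_add.trans h, le_add_self.trans h⟩, fun ⟨h₁, h₂⟩ => ?_⟩
  rintro (w | w)
  · simpa using h₁ (Sum.inl w)
  · simpa using h₂ (Sum.inr w)

/-- Divisibility of a monomial multiple of `x_i₀ y_j₀` by a product of two edges. -/
lemma exists_edgeExps_add_le_iff {A : Fin d → Prop} {K r : Fin d → Fin d → Prop} {i₀ j₀ : Fin d}
    (hr : ∀ i j, r i j → A i ∨ K i j) (hKr : ∀ i j, K i j → r i j) (hi₀ : ∀ j, r i₀ j)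
    (hA : ∀ i, A i → r i j₀) (hK : ∀ i j, K i j → i ≠ i₀ ∧ j ≠ j₀)
    (u : Fin d ⊕ Fin d →₀ ℕ) :
    (∃ v, (∃ s ∈ edgeExps r, ∃ t ∈ edgeExps r, s + t = v) ∧ v ≤ u + (xExp i₀ + yExp j₀)) ↔
      (∃ s ∈ xExps A ∪ edgeExps K, s ≤ u) ∧ ∃ s ∈ yExps d, s ≤ u := by
  constructor
  · rintro ⟨_, ⟨_, ⟨i, j, hij, rfl⟩, _, ⟨i', j', hij', rfl⟩, rfl⟩, hle⟩
    have hx (w : Fin d) := hle (Sum.inl w)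
    have hy (w : Fin d) := hle (Sum.inr w)
    simp only [Finsupp.add_apply, Finsupp.single_apply, Sum.inl.injEq, Sum.inr.injEq,
      reduceCtorEq, if_false, add_zero, zero_add] at hx hy
    have hKle {p q : Fin d} (hpq : K p q) (hp : p = i ∨ p = i') (hq : q = j ∨ q = j') :
        ∃ s ∈ xExps A ∪ edgeExps K, s ≤ u := by
      refine ⟨_, Or.inr ⟨p, q, hpq, rfl⟩, xExp_add_yExp_le.2 ⟨?_, ?_⟩⟩
      · have := hx p
        have := (hK p q hpq).1.symm
        grind
      · have := hy q
        have := (hK p q hpq).2.symm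
        grind
    refine ⟨?_, ?_⟩
    · rcases hr _ _ hij with hi | hk
      · rcases hr _ _ hij' with hi' | hk
        · by_cases h : i = i₀
          · refine ⟨_, Or.inl ⟨i', hi', rfl⟩, xExp_le.2 ?_⟩
            have := hx i'
            grind
          · refine ⟨_, Or.inl ⟨i, hi, rfl⟩, xExp_le.2 ?_⟩
            have := hx i
            grind
        · exact hKle hk (Or.inr rfl) (Or.inr rfl)
      · exact hKle hk (Or.inl rfl) (Or.inl rfl)
    · by_cases h : j = j₀
      · refine ⟨_, ⟨j', rfl⟩, yExp_le.2 ?_⟩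
        have := hy j'
        grind
      · refine ⟨_, ⟨j, rfl⟩, yExp_le.2 ?_⟩
        have := hy j
        grind
  · rintro ⟨⟨_, ⟨i, hi, rfl⟩ | ⟨i, j, hij, rfl⟩, hle⟩, _, ⟨j', rfl⟩, hle'⟩
    · refine ⟨_, ⟨_, ⟨i₀, j', hi₀ _, rfl⟩, _, ⟨i, j₀, hA _ hi, rfl⟩, rfl⟩, ?_⟩
      rw [show xExp i₀ + yExp j' + (xExp i + yExp j₀) =
        xExp i + yExp j' + (xExp i₀ + yExp j₀) by abel]
      exact add_le_add_left (xExp_add_yExp_le.2 ⟨xExp_le.1 hle, yExp_le.1 hle'⟩) _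
    · exact ⟨_, ⟨_, ⟨i, j, hKr _ _ hij, rfl⟩, _, ⟨i₀, j₀, hi₀ _, rfl⟩, rfl⟩,
        add_le_add_left hle _⟩

lemma colon_sq_edgeExps {A : Fin d → Prop} {K r : Fin d → Fin d → Prop} {i₀ j₀ : Fin d}
    (hr : ∀ i j, r i j → A i ∨ K i j) (hKr : ∀ i j, K i j → r i j) (hi₀ : ∀ j, r i₀ j)
    (hA : ∀ i, A i → r i j₀) (hK : ∀ i j, K i j → i ≠ i₀ ∧ j ≠ j₀) :
    Submodule.colon (monomialIdeal k (edgeExps r) ^ 2)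
        (Ideal.span {monomial (xExp i₀ + yExp j₀) (1 : k)}) =
      monomialIdeal k (xExps A ∪ edgeExps K) ⊓ monomialIdeal k (yExps d) := by
  ext f
  rw [monomialIdeal_sq, mem_colon_monomialIdeal, Submodule.mem_inf, mem_monomialIdeal,
    mem_monomialIdeal, ← forall₂_and]
  exact forall₂_congr fun u _ => exists_edgeExps_add_le_iff hr hKr hi₀ hA hK u

lemma monomialIdeal_sup_yExps (A : Fin d → Prop) (K : Fin d → Fin d → Prop) :
    monomialIdeal k (xExps A ∪ edgeExps K) ⊔ monomialIdeal k (yExps d) =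
      monomialIdeal k (xExps A ∪ yExps d) := by
  rw [monomialIdeal_sup]
  refine le_antisymm (monomialIdeal_le ?_) (monomialIdeal_le ?_)
  · rintro _ ((hs | ⟨i, j, -, rfl⟩) | hs)
    · exact ⟨_, Or.inl hs, le_rfl⟩
    · exact ⟨_, Or.inr ⟨j, rfl⟩, le_add_self⟩
    · exact ⟨_, Or.inr hs, le_rfl⟩
  · rintro s (hs | hs)
    · exact ⟨s, Or.inl (Or.inl hs), le_rfl⟩
    · exact ⟨s, Or.inr hs, le_rfl⟩

open localCohomology in
/-- A Mayer–Vietoris depth estimate, in terms of the variables avoided by the generators. -/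
lemma le_depthQuot_inf_yExps {A : Fin d → Prop} {K : Fin d → Fin d → Prop} {n p q : ℕ}
    {f : Fin p → Fin d} (hf : Function.Injective f) (hfA : ∀ l, ¬ A (f l))
    {g : Fin q → Fin d} (hg : Function.Injective g) (hgK : ∀ l i, ¬ K i (g l))
    (hp : n ≤ p + 1) (hq : n ≤ q) (hd : n ≤ d) :
    n ≤ depthQuot k
      (monomialIdeal k (xExps A ∪ edgeExps K) ⊓ monomialIdeal k (yExps d)) := by
  refine le_depthQuot (inf_le_right.trans ?_) fun i hi => ?_
  · rw [maxHomIdeal_eq_monomialIdeal]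
    refine monomialIdeal_le ?_
    rintro _ ⟨j, rfl⟩
    exact ⟨_, ⟨Sum.inr j, rfl⟩, le_rfl⟩
  · refine Vanishes.inf (vanishes_monomialIdeal (Sum.inr_injective.comp hg) ?_ (hi.trans_le hq))
      (vanishes_monomialIdeal (v := Sum.inl) Sum.inl_injective ?_ (hi.trans_le hd)) fun l hl => ?_
    · rintro _ (⟨i, -, rfl⟩ | ⟨i, j, hij, rfl⟩) l
      · simp
      · have : g l ≠ j := by
          rintro rfl
          exact hgK l i hij
        simp [this.symm]
    · rintro _ ⟨j, rfl⟩ l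
      simp
    · rw [monomialIdeal_sup_yExps]
      refine vanishes_monomialIdeal (Sum.inl_injective.comp hf) ?_ (by omega)
      rintro _ (⟨i, hi, rfl⟩ | ⟨j, rfl⟩) l
      · have : f l ≠ i := by
          rintro rfl
          exact hfA l hi
        simp [this.symm]
      · simp

end Bipartite

end MonomialIdeals

/-- Here the ideal `I` is the edge ideal
`I(G_{d,a}) = x_1(y_1, …, y_d) + (x_i y_j : 2 ≤ i ≤ j ≤ a) + (x_i y_j : a+1 ≤ i ≤ j ≤ d)`
of the bipartite graph `G_{d,a}`, with `x_i = X (inl i)`, `y_i = X (inr i)` and `1`-based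
indices translated to `0`-based `Fin d` indices.
Then `depth S/(I(G_{d,a})^2 : (x_1 y_d)) ≥ min (a, d - a + 1)`. -/
theorem depth_colon_square_two_drops_graph (k : Type) [Field k] (d a : ℕ)
    (hd : 5 ≤ d) (ha2 : 2 ≤ a) (had : a ≤ d - 1)
    (I : Ideal (MvPolynomial (Fin d ⊕ Fin d) k))
    (hI : I = Ideal.span
      ({p | ∃ i : Fin d, p = X (Sum.inl (⟨0, by omega⟩ : Fin d)) * X (Sum.inr i)} ∪
       {p | ∃ i jm : Fin d, 1 ≤ (i : ℕ) ∧ i ≤ jm ∧ (jm : ℕ) < a ∧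
          p = X (Sum.inl i) * X (Sum.inr jm)} ∪
       {p | ∃ i jm : Fin d, a ≤ (i : ℕ) ∧ i ≤ jm ∧
          p = X (Sum.inl i) * X (Sum.inr jm)})) :
    min a (d - a + 1) ≤
      depthQuot k (Submodule.colon (I ^ 2)
        (Ideal.span {(X (Sum.inl (⟨0, by omega⟩ : Fin d)) *
          X (Sum.inr (⟨d - 1, by omega⟩ : Fin d)) : MvPolynomial (Fin d ⊕ Fin d) k)})) := by
  let i₀ : Fin d := ⟨0, by omega⟩
  let j₀ : Fin d := ⟨d - 1, by omega⟩
  let A : Fin d → Prop := fun i => (i : ℕ) = 0 ∨ a ≤ (i : ℕ)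
  let K : Fin d → Fin d → Prop := fun i j => 1 ≤ (i : ℕ) ∧ i ≤ j ∧ (j : ℕ) < a
  let r : Fin d → Fin d → Prop := fun i j => (i : ℕ) = 0 ∨ K i j ∨ a ≤ (i : ℕ) ∧ i ≤ j
  have hmul (i j : Fin d) : (X (Sum.inl i) * X (Sum.inr j) : MvPolynomial (Fin d ⊕ Fin d) k) =
      monomial (xExp i + yExp j) 1 := by
    rw [X, X, monomial_mul, one_mul]
  have hIr : I = monomialIdeal k (edgeExps r) := by
    rw [hI, monomialIdeal]
    congr 1
    ext f
    simp only [hmul]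
    constructor
    · rintro ((⟨j, rfl⟩ | ⟨i, j, h₁, h₂, h₃, rfl⟩) | ⟨i, j, h₁, h₂, rfl⟩)
      · exact ⟨_, ⟨i₀, j, Or.inl rfl, rfl⟩, rfl⟩
      · exact ⟨_, ⟨i, j, Or.inr (Or.inl ⟨h₁, h₂, h₃⟩), rfl⟩, rfl⟩
      · exact ⟨_, ⟨i, j, Or.inr (Or.inr ⟨h₁, h₂⟩), rfl⟩, rfl⟩
    · rintro ⟨_, ⟨i, j, h | ⟨h₁, h₂, h₃⟩ | ⟨h₁, h₂⟩, rfl⟩, rfl⟩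
      · obtain rfl : i = i₀ := Fin.ext h
        exact Or.inl (Or.inl ⟨j, rfl⟩)
      · exact Or.inl (Or.inr ⟨i, j, h₁, h₂, h₃, rfl⟩)
      · exact Or.inr ⟨i, j, h₁, h₂, rfl⟩
  rw [hIr, hmul, colon_sq_edgeExps (A := A) (K := K) (i₀ := i₀) (j₀ := j₀)]
  · refine le_depthQuot_inf_yExps (p := a - 1) (q := d - a + 1)
      (f := fun l => ⟨l + 1, by omega⟩)
      (g := fun l => ⟨if (l : ℕ) = 0 then 0 else a + l - 1, by split_ifs <;> omega⟩)
      ?_ ?_ ?_ ?_ ?_ ?_ ?_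
    · intro l l' h
      simp only [Fin.mk.injEq] at h
      omega
    · intro l h
      simp only [A] at h
      omega
    · intro l l' h
      simp only [Fin.mk.injEq] at h
      split_ifs at h <;> omega
    · intro l i h
      simp only [K, Fin.le_def] at h
      split_ifs at h <;> omega
    · omega
    · omega
    · omega
  · intro i j h
    simp only [r, A] at h ⊢
    tauto
  · exact fun i j h => Or.inr (Or.inl h)
  · exact fun j => Or.inl rfl
  · rintro i (h | h)
    · exact Or.inl h
    · refine Or.inr (Or.inr ⟨h, ?_⟩)
      simp only [j₀, Fin.le_def]
      omega
  · rintro i j ⟨h₁, h₂, h₃⟩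
    simp only [i₀, j₀, Ne, Fin.ext_iff]
    omega
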